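/- arXiv:math/0103095 — 4 statements merged into one kernel-verified Lean document; each statement's English description precedes it below -/
import Mathlib

section
/- Let S, T and T' be complex vector spaces, let ρ be a Clifford multiplication of ℝ^m on S, let σ be a Clifford multiplication of ℝ^n on T and σ' a Clifford multiplication of ℝ^n on T', and let τ : T ≃ T' be a ℂ-linear equivalence satisfying τ ∘ σ(w) = −σ'(w) ∘ τ for every w ∈ ℝ^n. For v ∈ ℝ^m and w ∈ ℝ^n define γ(v,w) on the direct sum (S ⊗[ℂ] T) ⊕ (S ⊗[ℂ] T') by γ(v,w)(x, y) = ( i • (ρ(v) ⊗ τ⁻¹)(y) − (id_S ⊗ (τ⁻¹ ∘ σ'(w)))(y) , −i • (ρ(v) ⊗ τ)(x) + (id_S ⊗ (τ ∘ σ(w)))(x) ). Then for all v ∈ ℝ^m and w ∈ ℝ^n one has γ(v,w) ∘ γ(v,w) = −(‖v‖² + ‖w‖²) • id; in other words, (v,w) ↦ γ(v,w) is a Clifford multiplication of ℝ^m × ℝ^n on (S ⊗ T) ⊕ (S ⊗ T'). -/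
open TensorProduct

/-- if `ρ` is a Clifford multiplication of `ℝ^m` on `S`, `σ` and `σ'`
Clifford multiplications of `ℝ^n` on `T` and `T'`, and `τ : T ≃ T'` is a ℂ-linear
equivalence with `τ ∘ σ w = -(σ' w ∘ τ)`, then
`γ (v, w) (x, y) = (i • (ρ v ⊗ τ⁻¹) y - (id ⊗ (τ⁻¹ ∘ σ' w)) y,
  -i • (ρ v ⊗ τ) x + (id ⊗ (τ ∘ σ w)) x)` is a Clifford multiplication of
`ℝ^m × ℝ^n` on `(S ⊗ T) ⊕ (S ⊗ T')`. -/
theorem statement2 (m n : ℕ) (S T T' : Type*) [AddCommGroup S] [Module ℂ S]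
    [AddCommGroup T] [Module ℂ T] [AddCommGroup T'] [Module ℂ T']
    (ρ : EuclideanSpace ℝ (Fin m) →ₗ[ℝ] Module.End ℂ S)
    (σ : EuclideanSpace ℝ (Fin n) →ₗ[ℝ] Module.End ℂ T)
    (σ' : EuclideanSpace ℝ (Fin n) →ₗ[ℝ] Module.End ℂ T')
    (hρ : ∀ v, ρ v * ρ v = -((‖v‖ ^ 2 : ℝ) • (1 : Module.End ℂ S)))
    (hσ : ∀ w, σ w * σ w = -((‖w‖ ^ 2 : ℝ) • (1 : Module.End ℂ T)))
    (hσ' : ∀ w, σ' w * σ' w = -((‖w‖ ^ 2 : ℝ) • (1 : Module.End ℂ T')))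
    (τ : T ≃ₗ[ℂ] T')
    (hτ : ∀ w, τ.toLinearMap ∘ₗ σ w = -(σ' w ∘ₗ τ.toLinearMap))
    (γ : EuclideanSpace ℝ (Fin m) → EuclideanSpace ℝ (Fin n) →
      Module.End ℂ ((S ⊗[ℂ] T) × (S ⊗[ℂ] T')))
    (hγ : ∀ v w x y, γ v w (x, y) =
      (Complex.I • TensorProduct.map (ρ v) τ.symm.toLinearMap y
          - TensorProduct.map (LinearMap.id : S →ₗ[ℂ] S)
              (τ.symm.toLinearMap ∘ₗ σ' w) y,
        (-Complex.I) • TensorProduct.map (ρ v) τ.toLinearMap x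
          + TensorProduct.map (LinearMap.id : S →ₗ[ℂ] S)
              (τ.toLinearMap ∘ₗ σ w) x)) :
    ∀ v w, γ v w * γ v w =
      -(((‖v‖ ^ 2 + ‖w‖ ^ 2 : ℝ)) •
        (1 : Module.End ℂ ((S ⊗[ℂ] T) × (S ⊗[ℂ] T')))) := by
  intro v w
  have h1 : ∀ s, ρ v (ρ v s) = -((((‖v‖ ^ 2 : ℝ) : ℂ)) • s) := fun s => by
    have := LinearMap.congr_fun (hρ v) s
    rw [Complex.coe_smul]
    simpa using this
  have h2 : ∀ s, σ w (σ w s) = -((((‖w‖ ^ 2 : ℝ) : ℂ)) • s) := fun s => by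
    have := LinearMap.congr_fun (hσ w) s
    rw [Complex.coe_smul]
    simpa using this
  have h3 : ∀ s, σ' w (σ' w s) = -((((‖w‖ ^ 2 : ℝ) : ℂ)) • s) := fun s => by
    have := LinearMap.congr_fun (hσ' w) s
    rw [Complex.coe_smul]
    simpa using this
  have h4 : ∀ t, τ (σ w t) = -σ' w (τ t) := fun t => by
    simpa using LinearMap.congr_fun (hτ w) t
  have h5 : ∀ t, τ.symm (σ' w t) = -σ w (τ.symm t) := fun t => by
    apply τ.injective
    simp [h4]
  have hr : (((‖v‖ ^ 2 + ‖w‖ ^ 2 : ℝ)) •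
        (1 : Module.End ℂ ((S ⊗[ℂ] T) × (S ⊗[ℂ] T')))) =
      ((((‖v‖ ^ 2 : ℝ) : ℂ) + ((‖w‖ ^ 2 : ℝ) : ℂ))) • 1 := by
    rw [← Complex.ofReal_add]
    generalize (‖v‖ ^ 2 + ‖w‖ ^ 2 : ℝ) = r
    apply LinearMap.ext
    intro x
    change r • x = (r : ℂ) • x
    exact (algebraMap_smul ℂ r x).symm
  rw [hr]
  generalize ((‖v‖ ^ 2 : ℝ) : ℂ) = a at *
  generalize ((‖w‖ ^ 2 : ℝ) : ℂ) = b at *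
  apply LinearMap.prod_ext
  · apply TensorProduct.ext'
    intro s t
    simp [hγ, h1, h2, h3, h4, h5, TensorProduct.neg_tmul, TensorProduct.tmul_neg,
      TensorProduct.smul_tmul', smul_smul, add_smul, TensorProduct.add_tmul]
    have hI : Complex.I * (Complex.I * a) = -a := by
      rw [← mul_assoc, Complex.I_mul_I, neg_one_mul]
    simp only [hI, neg_smul, TensorProduct.neg_tmul]
    abel
  · apply TensorProduct.ext'
    intro s t
    simp [hγ, h1, h2, h3, h4, h5, TensorProduct.neg_tmul, TensorProduct.tmul_neg,
      TensorProduct.smul_tmul', smul_smul, add_smul, TensorProduct.add_tmul]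
    have hI : Complex.I * (Complex.I * a) = -a := by
      rw [← mul_assoc, Complex.I_mul_I, neg_one_mul]
    simp only [hI, neg_smul, TensorProduct.neg_tmul]
    abel
end

section
/- Let m and n be even positive natural numbers, S and T complex vector spaces, ρ a Clifford multiplication of ℝ^m on S and σ a Clifford multiplication of ℝ^n on T. Let (f_1, …, f_m) be an orthonormal basis of ℝ^m and (w_1, …, w_n) an orthonormal basis of ℝ^n. Set ε := i^{n/2} • (σ(w_1) ∘ … ∘ σ(w_n)) and, for v ∈ ℝ^m, u ∈ ℝ^n, γ(v,u) := ρ(v) ⊗ ε + id_S ⊗ σ(u). Then i^{(m+n)/2} • (γ(f_1,0) ∘ … ∘ γ(f_m,0) ∘ γ(0,w_1) ∘ … ∘ γ(0,w_n)) = (i^{m/2} • (ρ(f_1) ∘ … ∘ ρ(f_m))) ⊗ (i^{n/2} • (σ(w_1) ∘ … ∘ σ(w_n))). (That is, the image of the complex volume element under the induced representation γ is the tensor product of the volume operators of S and T.) -/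
open TensorProduct

theorem aux_anti {R : Type*} [Ring R] (a : R) (l : List R) (h : ∀ b ∈ l, a * b = -(b * a)) :
    l.prod * a = (-1) ^ l.length * (a * l.prod) := by
  induction l with
  | nil => simp
  | cons b l ih =>
    have h1 := h b (by simp)
    have h2 := ih (fun c hc => h c (by simp [hc]))
    have hc : Commute b ((-1 : R) ^ l.length) := (Commute.neg_one_right b).pow_right _
    rw [List.prod_cons, List.length_cons, mul_assoc, h2, ← mul_assoc, hc.eq, mul_assoc, ← mul_assoc b,
      pow_succ, ← mul_assoc a b, h1]
    simp [mul_assoc]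

theorem aux_sq {R : Type*} [Ring R] (l : List R) (h : l.Pairwise (fun a b => a * b = -(b * a)))
    (h2 : ∀ a ∈ l, a * a = -1) :
    l.prod * l.prod = (-1) ^ (∑ i ∈ Finset.range (l.length + 1), i) := by
  induction l with
  | nil => simp
  | cons a l ih =>
    rw [List.pairwise_cons] at h
    have h3 := aux_anti a l h.1
    have h4 := ih h.2 (fun c hc => h2 c (by simp [hc]))
    have hc : Commute a ((-1 : R) ^ l.length) := (Commute.neg_one_right a).pow_right _
    rw [List.prod_cons, List.length_cons, Finset.sum_range_succ]
    calc a * l.prod * (a * l.prod) = a * (l.prod * a) * l.prod := by simp only [mul_assoc]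
      _ = (-1) ^ l.length * (a * a) * (l.prod * l.prod) := by
        rw [h3, ← mul_assoc a, hc.eq]; simp only [mul_assoc]
      _ = _ := by
        rw [h2 a (by simp), h4, ← pow_succ, ← pow_add, add_comm]

theorem aux_clifford {n : ℕ} {T : Type*} [AddCommGroup T] [Module ℂ T]
    (σ : EuclideanSpace ℝ (Fin n) →ₗ[ℝ] Module.End ℂ T)
    (hσ : ∀ u, σ u * σ u = -((‖u‖ ^ 2 : ℝ) • (1 : Module.End ℂ T)))
    (u v : EuclideanSpace ℝ (Fin n)) (h : inner ℝ u v = 0) :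
    σ u * σ v = -(σ v * σ u) := by
  have h1 := hσ (u + v)
  have h2 : ‖u + v‖ ^ 2 = ‖u‖ ^ 2 + ‖v‖ ^ 2 := by
    rw [norm_add_sq_real, h]; ring
  rw [h2, map_add, add_mul, mul_add, mul_add, hσ u, hσ v, add_smul] at h1
  rw [eq_neg_iff_add_eq_zero]
  have h3 := sub_eq_zero.mpr h1
  rw [← h3]; abel

theorem aux_eps (n : ℕ) (hn : Even n) {T : Type*} [AddCommGroup T] [Module ℂ T]
    (σ : EuclideanSpace ℝ (Fin n) →ₗ[ℝ] Module.End ℂ T)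
    (hσ : ∀ u, σ u * σ u = -((‖u‖ ^ 2 : ℝ) • (1 : Module.End ℂ T)))
    (w : OrthonormalBasis (Fin n) ℝ (EuclideanSpace ℝ (Fin n)))
    (ε : Module.End ℂ T)
    (hε : ε = Complex.I ^ (n / 2) • ((List.finRange n).map (fun j => σ (w j))).prod) :
    ε * ε = 1 := by
  have h := aux_sq ((List.finRange n).map (fun j => σ (w j)))
    (by
      rw [List.pairwise_map]
      exact (List.nodup_finRange n).imp (fun {a b} hab =>
        aux_clifford σ hσ _ _ (w.orthonormal.2 hab)))
    (by
      intro a ha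
      obtain ⟨j, -, rfl⟩ := List.mem_map.1 ha
      rw [hσ]; simp)
  rw [hε, smul_mul_smul_comm, h, ← pow_add, List.length_map, List.length_finRange]
  obtain ⟨k, rfl⟩ := hn
  have e1 : (k + k) / 2 = k := by omega
  have e2 : ∑ i ∈ Finset.range (k + k + 1), i = k + 2 * (k * k) := by
    have := Finset.sum_range_id_mul_two (k + k + 1)
    have h' : (k + k + 1) * (k + k + 1 - 1) = (k + 2 * (k * k)) * 2 := by
      rw [Nat.add_sub_cancel]; ring
    omega
  rw [e1, e2, pow_add (-1 : Module.End ℂ T), pow_mul, neg_one_sq, one_pow, mul_one, ← two_mul,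
    pow_mul, Complex.I_sq]
  rcases Nat.even_or_odd k with hk | hk <;> simp [hk.neg_one_pow]

theorem aux_prod {S T ι : Type*} [AddCommGroup S] [Module ℂ S] [AddCommGroup T] [Module ℂ T]
    (a : ι → Module.End ℂ S) (b : ι → Module.End ℂ T) (l : List ι) :
    (l.map (fun i => (TensorProduct.map (a i) (b i) : Module.End ℂ (S ⊗[ℂ] T)))).prod =
      TensorProduct.map (l.map a).prod (l.map b).prod := by
  induction l with
  | nil => simp
  | cons i l ih => simp only [List.map_cons, List.prod_cons, ih, TensorProduct.map_mul]

/-- for `m`, `n` even and positive, Clifford multiplications `ρ` of `ℝ^m`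
on `S` and `σ` of `ℝ^n` on `T`, orthonormal bases `f` of `ℝ^m` and `w` of `ℝ^n`,
`ε = i^(n/2) • (σ (w 1) ∘ ⋯ ∘ σ (w n))` and `γ (v, u) = ρ v ⊗ ε + id ⊗ σ u`, the image
under `γ` of the complex volume element is the tensor product of the volume operators
of `S` and `T`. -/
theorem statement9 (m n : ℕ) (hm : Even m) (hn : Even n) (hm0 : 0 < m) (hn0 : 0 < n)
    (S T : Type*) [AddCommGroup S] [Module ℂ S] [AddCommGroup T] [Module ℂ T]
    (ρ : EuclideanSpace ℝ (Fin m) →ₗ[ℝ] Module.End ℂ S)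
    (σ : EuclideanSpace ℝ (Fin n) →ₗ[ℝ] Module.End ℂ T)
    (hρ : ∀ v, ρ v * ρ v = -((‖v‖ ^ 2 : ℝ) • (1 : Module.End ℂ S)))
    (hσ : ∀ u, σ u * σ u = -((‖u‖ ^ 2 : ℝ) • (1 : Module.End ℂ T)))
    (f : OrthonormalBasis (Fin m) ℝ (EuclideanSpace ℝ (Fin m)))
    (w : OrthonormalBasis (Fin n) ℝ (EuclideanSpace ℝ (Fin n)))
    (ε : Module.End ℂ T)
    (hε : ε = Complex.I ^ (n / 2) • ((List.finRange n).map (fun j => σ (w j))).prod)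
    (γ : EuclideanSpace ℝ (Fin m) → EuclideanSpace ℝ (Fin n) →
      Module.End ℂ (S ⊗[ℂ] T))
    (hγ : ∀ v u, γ v u = TensorProduct.map (ρ v) ε +
      TensorProduct.map (LinearMap.id : S →ₗ[ℂ] S) (σ u)) :
    Complex.I ^ ((m + n) / 2) •
        (((List.finRange m).map (fun i => γ (f i) 0)).prod *
          ((List.finRange n).map (fun j => γ 0 (w j))).prod) =
      TensorProduct.map
        (Complex.I ^ (m / 2) • ((List.finRange m).map (fun i => ρ (f i))).prod)
        (Complex.I ^ (n / 2) • ((List.finRange n).map (fun j => σ (w j))).prod) := by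
  have hee := aux_eps n hn σ hσ w ε hε
  have g1 : ∀ i, γ (f i) 0 = TensorProduct.map (ρ (f i)) ε := by
    intro i; rw [hγ]; simp
  have g2 : ∀ j, γ 0 (w j) = TensorProduct.map (1 : Module.End ℂ S) (σ (w j)) := by
    intro j; rw [hγ, map_zero, TensorProduct.map_zero_left, zero_add]; rfl
  simp only [g1, g2]
  rw [aux_prod (fun i => ρ (f i)) (fun _ => ε), aux_prod (fun _ => 1) (fun j => σ (w j)),
    ← TensorProduct.map_mul]
  have hem : ε ^ m = 1 := by
    obtain ⟨k, rfl⟩ := hm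
    rw [← two_mul, pow_mul, pow_two, hee, one_pow]
  have hd : (m + n) / 2 = m / 2 + n / 2 := by
    obtain ⟨k, rfl⟩ := hm
    omega
  simp [List.map_const', hem, hd, pow_add, TensorProduct.map_smul_left,
    TensorProduct.map_smul_right, smul_smul, mul_comm]
end

section
/- Let m be a natural number and n an odd natural number, S and T complex vector spaces, ρ a Clifford multiplication of ℝ^m on S and σ a Clifford multiplication of ℝ^n on T, and η a ℂ-linear endomorphism of S with η ∘ η = id_S and η ∘ ρ(v) = −ρ(v) ∘ η for all v ∈ ℝ^m. Let (w_1, …, w_n) be an orthonormal basis of ℝ^n and j ∈ {0,1} such that i^{(n+1)/2} • (σ(w_1) ∘ … ∘ σ(w_n)) = (−1)^j • id_T. For v ∈ ℝ^m, w ∈ ℝ^n define γ(v,w) := i • ((ρ(v) ∘ η) ⊗ id_T) + η ⊗ σ(w). Then for every v ∈ ℝ^m one has i^{(n+1)/2} • (γ(v,0) ∘ γ(0,w_1) ∘ … ∘ γ(0,w_n)) = (−1)^j • i • (ρ(v) ⊗ id_T). (This is the relation γ^j(v·ω_n) = (−1)^j i ρ(v) ⊗ Id of the paper.) -/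
open TensorProduct

/-- for `n` odd, Clifford multiplications `ρ` of `ℝ^m` on `S` and `σ` of
`ℝ^n` on `T` (of type `j`), `η` an involution of `S` anticommuting with each `ρ v`, and
`γ (v, w) = i • ((ρ v ∘ η) ⊗ id) + η ⊗ σ w`, one has the relation
`γ^j (v · ω_n) = (-1)^j i ρ(v) ⊗ Id` of the paper:
`i^((n+1)/2) • (γ (v,0) ∘ γ (0, w 1) ∘ ⋯ ∘ γ (0, w n)) = (-1)^j • i • (ρ v ⊗ id)`. -/
theorem statement11 (m n : ℕ) (hn : Odd n)
    (S T : Type*) [AddCommGroup S] [Module ℂ S] [AddCommGroup T] [Module ℂ T]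
    (ρ : EuclideanSpace ℝ (Fin m) →ₗ[ℝ] Module.End ℂ S)
    (σ : EuclideanSpace ℝ (Fin n) →ₗ[ℝ] Module.End ℂ T)
    (hρ : ∀ v, ρ v * ρ v = -((‖v‖ ^ 2 : ℝ) • (1 : Module.End ℂ S)))
    (hσ : ∀ u, σ u * σ u = -((‖u‖ ^ 2 : ℝ) • (1 : Module.End ℂ T)))
    (η : Module.End ℂ S)
    (hη : η * η = 1)
    (hηρ : ∀ v, η * ρ v = -(ρ v * η))
    (w : OrthonormalBasis (Fin n) ℝ (EuclideanSpace ℝ (Fin n)))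
    (j : ℕ) (hj : j = 0 ∨ j = 1)
    (hvolT : Complex.I ^ ((n + 1) / 2) •
        ((List.finRange n).map (fun k => σ (w k))).prod =
      ((-1 : ℂ) ^ j) • (1 : Module.End ℂ T))
    (γ : EuclideanSpace ℝ (Fin m) → EuclideanSpace ℝ (Fin n) →
      Module.End ℂ (S ⊗[ℂ] T))
    (hγ : ∀ v u, γ v u = Complex.I •
        TensorProduct.map (ρ v * η) (LinearMap.id : T →ₗ[ℂ] T) +
      TensorProduct.map η (σ u)) :
    ∀ v, Complex.I ^ ((n + 1) / 2) •
        (γ v 0 * ((List.finRange n).map (fun k => γ 0 (w k))).prod) =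
      ((-1 : ℂ) ^ j) • Complex.I •
        TensorProduct.map (ρ v) (LinearMap.id : T →ₗ[ℂ] T) := by
  intro v
  have hL : ∀ l : List (Fin n), (l.map (fun k => γ 0 (w k))).prod =
      TensorProduct.map (η ^ l.length) ((l.map (fun k => σ (w k))).prod) := by
    intro l
    induction l with
    | nil => simp [TensorProduct.map_one]
    | cons a l ih =>
      rw [List.map_cons, List.prod_cons, ih, hγ, List.map_cons, List.prod_cons,
        List.length_cons, pow_succ', TensorProduct.map_mul]
      simp
  have hpow : η ^ n = η := by
    obtain ⟨k, rfl⟩ := hn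
    rw [pow_succ, pow_mul, pow_two, hη, one_pow, one_mul]
  rw [hL, List.length_finRange, hpow, hγ, map_zero, TensorProduct.map_zero_right, add_zero,
    smul_mul_assoc, ← TensorProduct.map_mul, mul_assoc, hη, mul_one, smul_comm,
    ← TensorProduct.map_smul_right]
  have h1 : (LinearMap.id : T →ₗ[ℂ] T) * ((List.finRange n).map (fun k => σ (w k))).prod =
      ((List.finRange n).map (fun k => σ (w k))).prod := one_mul _
  rw [h1, hvolT, TensorProduct.map_smul_right, smul_comm]
  rfl
end

section
/- Let m ≥ 2 be a natural number and let a, h be real numbers with h > 0 and m·a > (m−1)·h². Set s := √(m·a/(m−1)). Then s − h > 0 and there exists a real number q with m·q ≠ 1, 1 + m·q² − 2·q > 0, (1 − m·q)² = (m−1)·h/(s − h), and a/(1 + m·q² − 2·q) − (m−1)·h²/(1 − m·q)² = (s − h)². (This is the choice of the function q and the resulting identity used to derive the eigenvalue estimate λ² ≥ (1/4)·inf(√(m(R+R^N_ψ)/(m−1)) − ‖H‖)² for the submanifold Dirac operator in Theorem 3.1.) -/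
/-- the choice of the function `q` in the proof of Theorem 3.1.
For `m ≥ 2`, `h > 0` and `m·a > (m-1)·h²`, setting `s = √(m·a/(m-1))`, one has
`s - h > 0` and there is a real `q` with `m·q ≠ 1`, `1 + m·q² - 2·q > 0`,
`(1 - m·q)² = (m-1)·h/(s-h)` and
`a/(1 + m·q² - 2·q) - (m-1)·h²/(1 - m·q)² = (s - h)²`. -/
theorem statement13 (m : ℕ) (hm : 2 ≤ m) (a h : ℝ) (hh : 0 < h)
    (hma : (m : ℝ) * a > ((m : ℝ) - 1) * h ^ 2) :
    0 < Real.sqrt ((m : ℝ) * a / ((m : ℝ) - 1)) - h ∧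
    ∃ q : ℝ, (m : ℝ) * q ≠ 1 ∧
      0 < 1 + (m : ℝ) * q ^ 2 - 2 * q ∧
      (1 - (m : ℝ) * q) ^ 2 =
        ((m : ℝ) - 1) * h / (Real.sqrt ((m : ℝ) * a / ((m : ℝ) - 1)) - h) ∧
      a / (1 + (m : ℝ) * q ^ 2 - 2 * q) -
          ((m : ℝ) - 1) * h ^ 2 / (1 - (m : ℝ) * q) ^ 2 =
        (Real.sqrt ((m : ℝ) * a / ((m : ℝ) - 1)) - h) ^ 2 := by
  have hm2 : (2 : ℝ) ≤ m := by exact_mod_cast hm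
  have hM : (0 : ℝ) < (m : ℝ) - 1 := by linarith
  have hm0 : (0 : ℝ) < (m : ℝ) := by linarith
  have hlt : h ^ 2 < (m : ℝ) * a / ((m : ℝ) - 1) := by
    rw [lt_div_iff₀ hM]; linarith
  have hs : h < Real.sqrt ((m : ℝ) * a / ((m : ℝ) - 1)) := Real.lt_sqrt_of_sq_lt hlt
  have hsq : Real.sqrt ((m : ℝ) * a / ((m : ℝ) - 1)) ^ 2 = (m : ℝ) * a / ((m : ℝ) - 1) :=
    Real.sq_sqrt (by nlinarith [sq_nonneg h])
  generalize Real.sqrt ((m : ℝ) * a / ((m : ℝ) - 1)) = s at hs hsq ⊢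
  have hd : 0 < s - h := by linarith
  have hs0 : 0 < s := by linarith
  have ha : a = ((m : ℝ) - 1) * s ^ 2 / m := by
    rw [hsq]; field_simp
  have ht : 0 < ((m : ℝ) - 1) * h / (s - h) := by positivity
  have hr := Real.sq_sqrt ht.le
  have hrp := Real.sqrt_pos.mpr ht
  generalize Real.sqrt (((m : ℝ) - 1) * h / (s - h)) = r at hr hrp
  have hq : (m : ℝ) * ((1 - r) / m) = 1 - r := by field_simp
  have hden : 1 + (m : ℝ) * ((1 - r) / m) ^ 2 - 2 * ((1 - r) / m)
      = ((m : ℝ) - 1) * s / (m * (s - h)) := by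
    have h1 : 1 + (m : ℝ) * ((1 - r) / m) ^ 2 - 2 * ((1 - r) / m)
      = (r ^ 2 + (m - 1)) / m := by field_simp; ring
    rw [h1, hr]; field_simp; ring
  have hrr : (1 - (m : ℝ) * ((1 - r) / m)) ^ 2 = ((m : ℝ) - 1) * h / (s - h) := by
    rw [hq, ← hr]; ring
  refine ⟨hd, (1 - r) / m, ?_, ?_, hrr, ?_⟩
  · rw [hq]; intro hc; linarith
  · rw [hden]; positivity
  · rw [hrr, hden, ha]
    have := hd.ne'
    have := hM.ne'
    field_simp
    try ring
end
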